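/- Let H be a real Hilbert space, F a real normed space, D : H → F a continuous linear map, and J : H → ℝ a convex function that is Fréchet differentiable at a point ũ ∈ H with D ũ = 0 and such that J(ũ) ≤ J(u) for every u ∈ H with D u = 0. Suppose there exists a continuous linear functional λ ∈ F* such that ⟨J'(ũ), v⟩ + λ(D v) = 0 for all v ∈ H. Let σ > ‖λ‖_{F*} and let ū ∈ H be a global minimizer of the penalized functional J_σ(u) := J(u) + σ‖D u‖. Then D ū = 0, and consequently ū is a global minimizer of J over the constraint set {u ∈ H : D u = 0} with J(ū) = J(ũ). -/

import Mathlib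

/-- The gradient inequality: a convex function lies above its tangent at a point of
Fréchet differentiability. -/
theorem ConvexOn.add_fderiv_apply_sub_le {E : Type*} [NormedAddCommGroup E] [NormedSpace ℝ E]
    {s : Set E} {f : E → ℝ} {f' : E →L[ℝ] ℝ} {x y : E} (hf : ConvexOn ℝ s f)
    (hx : x ∈ s) (hy : y ∈ s) (hf' : HasFDerivAt f f' x) :
    f x + f' (y - x) ≤ f y := by
  have hline : HasDerivAt (f ∘ AffineMap.lineMap x y) (f' (y - x)) (0 : ℝ) :=
    HasFDerivAt.comp_hasDerivAt (0 : ℝ) (by simpa using hf') AffineMap.hasDerivAt_lineMap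
  have hconv := hf.comp_affineMap (AffineMap.lineMap (k := ℝ) x y)
  have h := hconv.le_slope_of_hasDerivAt (x := 0) (y := 1)
    (by simpa using hx) (by simpa using hy) one_pos hline
  simp only [slope_def_field, Function.comp_apply, AffineMap.lineMap_apply_one,
    AffineMap.lineMap_apply_zero, sub_zero, div_one] at h
  linarith


/-- Exact penalization, part 2 (Theorem 3.1): for σ > ‖λ‖, any global minimizer ū of
the penalized functional J_σ(u) = J(u) + σ‖D u‖ satisfies D ū = 0, minimizes J over
the constraint set, and J(ū) = J(ũ). -/
theorem exact_penalization_exactness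
    {H : Type*} [NormedAddCommGroup H] [InnerProductSpace ℝ H] [CompleteSpace H]
    {F : Type*} [NormedAddCommGroup F] [NormedSpace ℝ F]
    (D : H →L[ℝ] F)
    (J : H → ℝ) (hJconv : ConvexOn ℝ Set.univ J)
    (u₀ : H) (J' : H →L[ℝ] ℝ) (hJ' : HasFDerivAt J J' u₀)
    (hdiv : D u₀ = 0) (hmin : ∀ u : H, D u = 0 → J u₀ ≤ J u)
    (lam : F →L[ℝ] ℝ) (hKKT : ∀ v : H, J' v + lam (D v) = 0)
    (σ : ℝ) (hσ : σ > ‖lam‖)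
    (ubar : H) (hubar : ∀ u : H, J ubar + σ * ‖D ubar‖ ≤ J u + σ * ‖D u‖) :
    D ubar = 0 ∧ (∀ u : H, D u = 0 → J ubar ≤ J u) ∧ J ubar = J u₀ := by
  have hgrad := hJconv.add_fderiv_apply_sub_le (Set.mem_univ u₀) (Set.mem_univ ubar) hJ'
  have hmult := hKKT (ubar - u₀)
  rw [map_sub D, hdiv, sub_zero] at hmult
  have hbound : lam (D ubar) ≤ ‖lam‖ * ‖D ubar‖ :=
    (le_abs_self _).trans (lam.le_opNorm (D ubar))
  have hpen := hubar u₀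
  rw [hdiv, norm_zero, mul_zero, add_zero] at hpen
  have hD : D ubar = 0 := by
    by_contra hne
    have := mul_lt_mul_of_pos_right hσ (norm_pos_iff.mpr hne)
    linarith
  rw [hD, norm_zero, mul_zero, add_zero] at hpen
  exact ⟨hD, fun u hu => hpen.trans (hmin u hu), le_antisymm hpen (hmin ubar hD)⟩
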